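/- arXiv:math/0601758 — 7 statements merged into one kernel-verified Lean document; each statement's English description precedes it below -/
import Mathlib

section
/- Let R be a (not necessarily commutative) ring and let a, b ∈ R satisfy ab = −ba, ab² = 0 and ba² = 0. Then for every integer s ≥ 1, (a + b)^s = a^s + b^s. -/
/-- If `a, b` in a ring satisfy `ab = −ba`, `ab² = 0` and `ba² = 0`, then
`(a + b)^s = a^s + b^s` for every `s ≥ 1`. -/
theorem add_pow_of_anticommute (R : Type*) [Ring R] (a b : R)
    (h1 : a * b = -(b * a)) (h2 : a * b ^ 2 = 0) (h3 : b * a ^ 2 = 0) :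
    ∀ s : ℕ, 1 ≤ s → (a + b) ^ s = a ^ s + b ^ s := by
  intro s hs
  induction s, hs using Nat.le_induction with
  | base => simp
  | succ n hn ih =>
    have key : a * b ^ n + b * a ^ n = 0 := by
      rcases Nat.lt_or_ge n 2 with h | h
      · obtain rfl : n = 1 := by omega
        simp [h1]
      · obtain ⟨k, rfl⟩ := Nat.exists_eq_add_of_le h
        rw [pow_add, pow_add, ← mul_assoc, ← mul_assoc, h2, h3]
        simp
    calc (a + b) ^ (n + 1) = (a + b) * (a ^ n + b ^ n) := by rw [pow_succ', ih]
      _ = a * a ^ n + b * b ^ n + (a * b ^ n + b * a ^ n) := by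
        rw [add_mul, mul_add, mul_add]; abel
      _ = a ^ (n + 1) + b ^ (n + 1) := by rw [key, add_zero, pow_succ', pow_succ']
end

section
/- Let A be a C*-algebra, let n ≥ 2 be an integer, and let a, b ∈ A satisfy b* = b^{n−1} and ab² = 0. Then ab = 0. -/
/-- In a C*-algebra, if `b* = b^{n-1}` (with `n ≥ 2`) and `ab² = 0`, then `ab = 0`. -/
theorem mul_eq_zero_of_star_pow
    (A : Type*) [NormedRing A] [StarRing A] [CStarRing A]
    [CompleteSpace A] [NormedAlgebra ℂ A] [StarModule ℂ A]
    (n : ℕ) (hn : 2 ≤ n) (a b : A)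
    (hb : star b = b ^ (n - 1)) (hab : a * b ^ 2 = 0) :
    a * b = 0 := by
  obtain ⟨k, rfl⟩ := Nat.exists_eq_add_of_le hn
  have hk : 2 + k - 1 = 1 + k := by omega
  rw [hk] at hb
  rw [← CStarRing.mul_star_self_eq_zero_iff, star_mul, hb]
  have h : a * b * (b ^ (1 + k) * star a) = a * b ^ 2 * (b ^ k * star a) := by
    simp only [pow_add, pow_one, pow_two, mul_assoc]
  rw [h, hab, zero_mul]
end

section
/- Let A be a C*-algebra and let a, b ∈ A satisfy ab = −ba, a* = a² and b* = b². Then ab = 0 and ba = 0. -/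
/-- In a C*-algebra, if `ab = −ba`, `a* = a²` and `b* = b²`, then `ab = 0` and `ba = 0`. -/
theorem mul_eq_zero_of_anticommute_of_star_eq_sq
    (A : Type*) [NormedRing A] [StarRing A] [CStarRing A]
    [CompleteSpace A] [NormedAlgebra ℂ A] [StarModule ℂ A]
    (a b : A) (h1 : a * b = -(b * a)) (ha : star a = a ^ 2) (hb : star b = b ^ 2) :
    a * b = 0 ∧ b * a = 0 := by
  have hc : Commute (a ^ 2) b := by
    show a ^ 2 * b = b * a ^ 2
    rw [pow_two, mul_assoc, h1, mul_neg, ← mul_assoc, h1, neg_mul, neg_neg, mul_assoc]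
  have h2 : star a * star b = star b * star a := by
    rw [ha, hb]
    exact (hc.pow_right 2).eq
  have h3 : b * a = a * b := by
    have := congrArg star h2
    simpa only [star_mul, star_star] using this
  have h4 : (2 : ℂ) • (a * b) = 0 := by
    rw [two_smul]
    nth_rewrite 1 [h1]
    rw [h3, neg_add_cancel]
  have h5 : a * b = 0 := (smul_eq_zero.mp h4).resolve_left two_ne_zero
  exact ⟨h5, h3.trans h5⟩
end

section
/- Let A be a *-ring (a ring with an involutive star operation satisfying (xy)* = y* x*) and let a, c ∈ A satisfy ac² = 0, a* = a² and c* = c². Then ca = 0. -/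
/-- In a *-ring, if `ac² = 0`, `a* = a²` and `c* = c²`, then `ca = 0`. -/
theorem mul_eq_zero_of_star_eq_sq (A : Type*) [Ring A] [StarRing A]
    (a c : A) (hac : a * c ^ 2 = 0) (ha : star a = a ^ 2) (hc : star c = c ^ 2) :
    c * a = 0 := by
  rw [← star_eq_zero, star_mul, ha, hc, pow_two a, mul_assoc, hac, mul_zero]
end

section
/- Let X be a connected k-regular simple graph on a finite vertex set of cardinality n with real adjacency matrix A, and let Y be an l-regular simple graph with real adjacency matrix B. Let J denote the n×n all-ones matrix. Then every eigenvalue of the matrix A ⊗ 1 + J ⊗ B (Kronecker products) is either of the form k + n·μ for some eigenvalue μ of B, or is an eigenvalue λ of A with λ ≠ k. -/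
open Matrix
open scoped Kronecker

theorem mem_spec_iff {ι : Type*} [Fintype ι] [DecidableEq ι] (M : Matrix ι ι ℝ) (μ : ℝ) :
    μ ∈ spectrum ℝ M ↔ ∃ v : ι → ℝ, v ≠ 0 ∧ M *ᵥ v = μ • v := by
  rw [← Matrix.spectrum_toLin', ← Module.End.hasEigenvalue_iff_mem_spectrum]
  constructor
  · intro h
    obtain ⟨v, hv⟩ := h.exists_hasEigenvector
    exact ⟨v, hv.2, by simpa using hv.apply_eq_smul⟩
  · rintro ⟨v, h0, hv⟩
    exact Module.End.hasEigenvalue_of_hasEigenvector (x := v)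
      ⟨Module.End.mem_eigenspace_iff.2 (by simpa using hv), h0⟩

/-- Spectrum of the adjacency matrix `A ⊗ 1 + J ⊗ B` of a lexicographic product
`X ∘ Y`, with `X` connected and `k`-regular on `n` vertices and `Y` `l`-regular:
every eigenvalue is either `k + n·μ` for an eigenvalue `μ` of `B`, or an
eigenvalue `λ ≠ k` of `A`. -/
theorem spectrum_lexicographic
    (α β : Type*) [Fintype α] [Fintype β] [DecidableEq α] [DecidableEq β]
    (X : SimpleGraph α) (Y : SimpleGraph β)
    [DecidableRel X.Adj] [DecidableRel Y.Adj]
    (k l n : ℕ) (hn : Fintype.card α = n)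
    (hX : X.Connected) (hXreg : X.IsRegularOfDegree k) (hYreg : Y.IsRegularOfDegree l)
    (J : Matrix α α ℝ) (hJ : ∀ i j, J i j = 1)
    (μ : ℝ)
    (hμ : μ ∈ spectrum ℝ
      ((X.adjMatrix ℝ) ⊗ₖ (1 : Matrix β β ℝ) + J ⊗ₖ (Y.adjMatrix ℝ))) :
    (∃ ν ∈ spectrum ℝ (Y.adjMatrix ℝ), μ = (k : ℝ) + (n : ℝ) * ν) ∨
    (μ ∈ spectrum ℝ (X.adjMatrix ℝ) ∧ μ ≠ (k : ℝ)) := by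
  obtain ⟨v, hv0, hv⟩ := (mem_spec_iff _ _).1 hμ
  have hne : Nonempty α := hX.nonempty
  have hn0 : (n : ℝ) ≠ 0 := by
    rw [← hn]; exact_mod_cast Fintype.card_ne_zero
  have key : ∀ i b, (∑ j, X.adjMatrix ℝ i j * v (j, b))
      + (∑ c, Y.adjMatrix ℝ b c * ∑ j, v (j, c)) = μ * v (i, b) := by
    intro i b
    have h := congrFun hv (i, b)
    rw [Matrix.add_mulVec, Pi.add_apply] at h
    simp only [Matrix.mulVec, dotProduct, Fintype.sum_prod_type, Matrix.kroneckerMap_apply, hJ,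
      one_mul, Pi.smul_apply, smul_eq_mul, Matrix.one_apply, mul_ite, mul_one, mul_zero,
      ite_mul, zero_mul, Finset.sum_ite_eq, Finset.mem_univ, if_true] at h
    rw [← h]
    congr 1
    rw [Finset.sum_comm]
    simp only [Finset.mul_sum]
  have hcol : ∀ j, ∑ i, X.adjMatrix ℝ i j = k := by
    intro j
    have h1 : ∀ i, X.adjMatrix ℝ i j = X.adjMatrix ℝ j i := fun i => by
      simp [SimpleGraph.adjMatrix_apply, X.adj_comm]
    simp only [h1]
    have h2 := X.adjMatrix_mulVec_const_apply_of_regular (a := (1 : ℝ)) hXreg (v := j)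
    simpa [Matrix.mulVec, dotProduct] using h2
  by_cases hs : (fun b => ∑ j, v (j, b)) = 0
  · right
    have hs' : ∀ b, ∑ j, v (j, b) = 0 := fun b => congrFun hs b
    obtain ⟨⟨i, b⟩, hib⟩ := Function.ne_iff.1 hv0
    have hA : X.adjMatrix ℝ *ᵥ (fun j => v (j, b)) = μ • (fun j => v (j, b)) := by
      funext i'
      have := key i' b
      simp only [hs', mul_zero, Finset.sum_const_zero, add_zero] at this
      simpa [Matrix.mulVec, dotProduct, -SimpleGraph.adjMatrix_apply] using this
    refine ⟨(mem_spec_iff _ _).2 ⟨_, fun h => hib (congrFun h i), hA⟩, ?_⟩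
    rintro rfl
    have hL : X.lapMatrix ℝ *ᵥ (fun j => v (j, b)) = 0 := by
      rw [SimpleGraph.lapMatrix, Matrix.sub_mulVec, hA]
      funext i'
      simp [SimpleGraph.degMatrix, Matrix.mulVec_diagonal, hXreg.degree_eq]
    have hc := (X.lapMatrix_mulVec_eq_zero_iff_forall_reachable).1 hL
    have hc' : ∀ j, v (j, b) = v (i, b) := fun j => hc j i (hX.preconnected j i)
    have := hs' b
    simp only [hc', Finset.sum_const, Finset.card_univ, hn, nsmul_eq_mul] at this
    exact hib ((mul_eq_zero.1 this).resolve_left hn0)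
  · left
    refine ⟨(μ - k) / n, (mem_spec_iff _ _).2 ⟨_, hs, ?_⟩, by field_simp; ring⟩
    funext b
    have h := Finset.sum_congr (rfl : (Finset.univ : Finset α) = _) (fun i _ => key i b)
    rw [Finset.sum_add_distrib, Finset.sum_comm] at h
    simp only [← Finset.sum_mul, hcol, ← Finset.mul_sum, Finset.sum_const, Finset.card_univ,
      hn, nsmul_eq_mul] at h
    simp only [Matrix.mulVec, dotProduct, Pi.smul_apply, smul_eq_mul]
    rw [div_mul_eq_mul_div, eq_div_iff hn0]
    linarith
end

section
/- The complement of the circulant graph C_10(4) is isomorphic as a simple graph to the lexicographic product K_2 ∘ C_5. -/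
open SimpleGraph

/-- The lexicographic product `X ∘ Y`: a copy of `X` at each vertex of `Y`;
`(i,α) ∼ (j,β)` iff `α ∼ β` in `Y`, or `α = β` and `i ∼ j` in `X`. -/
def SimpleGraph.lexProd {α β : Type*} (X : SimpleGraph α) (Y : SimpleGraph β) :
    SimpleGraph (α × β) where
  Adj x y := Y.Adj x.2 y.2 ∨ (x.2 = y.2 ∧ X.Adj x.1 y.1)
  symm := ⟨fun x y h => h.elim (fun h' => Or.inl h'.symm)
    (fun h' => Or.inr ⟨h'.1.symm, h'.2.symm⟩)⟩
  loopless := ⟨fun x h => h.elim (fun h' => Y.loopless.irrefl x.2 h')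
    (fun h' => X.loopless.irrefl x.1 h'.2)⟩

/-- The complement of the circulant graph `C₁₀(4)` is isomorphic to the
lexicographic product `K₂ ∘ C₅`. -/
theorem compl_C10_4_iso_lexProd :
    Nonempty
      ((circulantGraph ({1, 4} : Set (ZMod 10)))ᶜ ≃g
        (completeGraph (Fin 2)).lexProd (circulantGraph ({1} : Set (ZMod 5)))) := by
  refine ⟨⟨⟨fun x => ((⟨x.val % 2, Nat.mod_lt _ (by norm_num)⟩ : Fin 2), ((3 * x.val : ℕ) : ZMod 5)),
    fun p => ((5 * p.1.val + 2 * p.2.val : ℕ) : ZMod 10), ?_, ?_⟩, ?_⟩⟩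
  · unfold Function.LeftInverse
    decide
  · unfold Function.RightInverse Function.LeftInverse
    decide
  · simp only [SimpleGraph.lexProd, circulantGraph, compl_adj, fromRel_adj, Equiv.coe_fn_mk,
      Set.mem_insert_iff, Set.mem_singleton_iff, completeGraph, top_adj]
    decide
end

section
/- Let P be the Petersen graph, with vertices the 2-element subsets of Fin 5, and let V ⊆ ℂ^{V(P)} be the eigenspace of its adjacency operator for the eigenvalue 1 (a 5-dimensional subspace). The symmetric group S_5 = Perm(Fin 5) acts linearly on ℂ^{V(P)} by permuting coordinates via its natural action on 2-element subsets. Then V is invariant under this action, and the resulting linear representation of S_5 on V is irreducible: V ≠ 0 and the only S_5-invariant subspaces of V are 0 and V. -/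
open SimpleGraph

/-- The Petersen graph: vertices are the 2-element subsets of `Fin 5`,
adjacent iff disjoint. -/
def petersen : SimpleGraph {s : Finset (Fin 5) // s.card = 2} where
  Adj a b := Disjoint a.1 b.1
  symm := ⟨fun _ _ h => h.symm⟩
  loopless := ⟨fun a h => by
    have : a.1 = ∅ := disjoint_self.mp h
    have h2 := a.2
    rw [this] at h2
    simp at h2⟩

instance : DecidableRel petersen.Adj :=
  fun a b => inferInstanceAs (Decidable (Disjoint a.1 b.1))

/-- The natural action of a permutation of `Fin 5` on the vertices of the
Petersen graph (2-element subsets of `Fin 5`), acting elementwise. -/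
def vertAct (σ : Equiv.Perm (Fin 5)) (a : {s : Finset (Fin 5) // s.card = 2}) :
    {s : Finset (Fin 5) // s.card = 2} :=
  ⟨a.1.image σ, by rw [Finset.card_image_of_injective _ σ.injective]; exact a.2⟩

/-- The linear action of `S₅` on functions on the vertices of the Petersen
graph: `(σ · f)(s) = f(σ⁻¹ · s)`. -/
def permRep (σ : Equiv.Perm (Fin 5)) :
    ({s : Finset (Fin 5) // s.card = 2} → ℂ) →ₗ[ℂ]
      ({s : Finset (Fin 5) // s.card = 2} → ℂ) where
  toFun f := fun s => f (vertAct σ⁻¹ s)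
  map_add' _ _ := rfl
  map_smul' _ _ := rfl


abbrev PV := {s : Finset (Fin 5) // s.card = 2}

def pv (a b : Fin 5) (h : a ≠ b) : PV := ⟨{a, b}, Finset.card_pair h⟩

lemma vertAct_pv (σ : Equiv.Perm (Fin 5)) (a b : Fin 5) (h : a ≠ b) :
    vertAct σ (pv a b h) = pv (σ a) (σ b) (σ.injective.ne h) := by
  apply Subtype.ext
  simp [vertAct, pv, Finset.image_insert]

lemma vertAct_vertAct (σ τ : Equiv.Perm (Fin 5)) (a : PV) :
    vertAct σ (vertAct τ a) = vertAct (σ * τ) a := by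
  apply Subtype.ext
  simp [vertAct, Finset.image_image]

lemma vertAct_one (a : PV) : vertAct 1 a = a := by
  apply Subtype.ext
  simp [vertAct]

def vertEquiv (σ : Equiv.Perm (Fin 5)) : PV ≃ PV where
  toFun := vertAct σ
  invFun := vertAct σ⁻¹
  left_inv a := by rw [vertAct_vertAct, inv_mul_cancel, vertAct_one]
  right_inv a := by rw [vertAct_vertAct, mul_inv_cancel, vertAct_one]

lemma adj_vertAct (σ : Equiv.Perm (Fin 5)) (a b : PV) :
    petersen.Adj (vertAct σ a) (vertAct σ b) ↔ petersen.Adj a b := by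
  change Disjoint (a.1.image σ) (b.1.image σ) ↔ Disjoint a.1 b.1
  exact Finset.disjoint_image σ.injective

lemma pv_cases (s : PV) : s = pv 0 1 (by decide) ∨ s = pv 0 2 (by decide) ∨
    s = pv 0 3 (by decide) ∨ s = pv 0 4 (by decide) ∨ s = pv 1 2 (by decide) ∨
    s = pv 1 3 (by decide) ∨ s = pv 1 4 (by decide) ∨ s = pv 2 3 (by decide) ∨
    s = pv 2 4 (by decide) ∨ s = pv 3 4 (by decide) := by
  revert s; decide

def cyc (a b c d : Fin 5) : PV → ℂ := fun s =>
  (if s.1 = {a, b} then 1 else 0) - (if s.1 = {b, c} then 1 else 0)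
    + (if s.1 = {c, d} then 1 else 0) - (if s.1 = {d, a} then 1 else 0)

lemma permRep_cyc (σ : Equiv.Perm (Fin 5)) (a b c d : Fin 5) :
    permRep σ (cyc a b c d) = cyc (σ a) (σ b) (σ c) (σ d) := by
  have key : ∀ (s : PV) (x y : Fin 5),
      (vertAct σ⁻¹ s).1 = {x, y} ↔ s.1 = {σ x, σ y} := by
    intro s x y
    have : ({x, y} : Finset (Fin 5)) = ({σ x, σ y} : Finset (Fin 5)).image ⇑(σ⁻¹) := by
      simp [Finset.image_insert]
    rw [this]
    exact (Finset.image_injective (σ⁻¹).injective).eq_iff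
  funext s
  change cyc a b c d (vertAct σ⁻¹ s) = _
  simp only [cyc, key]

def T : (Fin 5 → ℂ) →ₗ[ℂ] (PV → ℂ) where
  toFun c := c 0 • cyc 0 4 1 2 + c 1 • cyc 2 4 1 0 + c 2 • cyc 1 3 0 2 + c 3 • cyc 2 3 0 1
    + c 4 • cyc 3 4 1 0
  map_add' x y := by simp only [Pi.add_apply, add_smul]; abel
  map_smul' r x := by simp only [Pi.smul_apply, smul_eq_mul, mul_smul, smul_add, RingHom.id_apply]

lemma mem_eig (f : PV → ℂ) :
    f ∈ Module.End.eigenspace ((petersen.adjMatrix ℂ).mulVecLin) 1 ↔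
      ∀ s, ∑ t, (if petersen.Adj s t then f t else 0) = f s := by
  rw [Module.End.mem_eigenspace_iff, one_smul, funext_iff]
  simp [Matrix.mulVec, dotProduct, adjMatrix_apply]

lemma sum_pv (g : PV → ℂ) : ∑ t, g t = g (pv 0 1 (by decide)) + g (pv 0 2 (by decide)) +
    g (pv 0 3 (by decide)) + g (pv 0 4 (by decide)) + g (pv 1 2 (by decide)) +
    g (pv 1 3 (by decide)) + g (pv 1 4 (by decide)) + g (pv 2 3 (by decide)) +
    g (pv 2 4 (by decide)) + g (pv 3 4 (by decide)) := by
  have : (Finset.univ : Finset PV) = {pv 0 1 (by decide), pv 0 2 (by decide),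
    pv 0 3 (by decide), pv 0 4 (by decide), pv 1 2 (by decide),
    pv 1 3 (by decide), pv 1 4 (by decide), pv 2 3 (by decide),
    pv 2 4 (by decide), pv 3 4 (by decide)} := by decide
  rw [this]
  repeat rw [Finset.sum_insert (by decide)]
  rw [Finset.sum_singleton]
  ring

lemma adj_pv (a b c d : Fin 5) (h : a ≠ b) (h' : c ≠ d) :
    petersen.Adj (pv a b h) (pv c d h') ↔ (a ≠ c ∧ a ≠ d ∧ b ≠ c ∧ b ≠ d) := by
  change Disjoint ({a, b} : Finset (Fin 5)) {c, d} ↔ _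
  simp; tauto

lemma mem_star (f : PV → ℂ) :
    f ∈ Module.End.eigenspace ((petersen.adjMatrix ℂ).mulVecLin) 1 ↔
      (f (pv 0 1 (by decide)) + f (pv 0 2 (by decide)) + f (pv 0 3 (by decide))
        + f (pv 0 4 (by decide)) = 0 ∧
      f (pv 0 1 (by decide)) + f (pv 1 2 (by decide)) + f (pv 1 3 (by decide))
        + f (pv 1 4 (by decide)) = 0 ∧
      f (pv 0 2 (by decide)) + f (pv 1 2 (by decide)) + f (pv 2 3 (by decide))
        + f (pv 2 4 (by decide)) = 0 ∧
      f (pv 0 3 (by decide)) + f (pv 1 3 (by decide)) + f (pv 2 3 (by decide))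
        + f (pv 3 4 (by decide)) = 0 ∧
      f (pv 0 4 (by decide)) + f (pv 1 4 (by decide)) + f (pv 2 4 (by decide))
        + f (pv 3 4 (by decide)) = 0) := by
  rw [mem_eig]
  simp only [sum_pv]
  constructor
  · intro h
    have h0 := h (pv 0 1 (by decide))
    have h1 := h (pv 0 2 (by decide))
    have h2 := h (pv 0 3 (by decide))
    have h3 := h (pv 0 4 (by decide))
    have h4 := h (pv 1 2 (by decide))
    have h5 := h (pv 1 3 (by decide))
    have h6 := h (pv 1 4 (by decide))
    have h7 := h (pv 2 3 (by decide))
    have h8 := h (pv 2 4 (by decide))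
    have h9 := h (pv 3 4 (by decide))
    clear h
    simp [adj_pv] at h0 h1 h2 h3 h4 h5 h6 h7 h8 h9
    refine ⟨?_, ?_, ?_, ?_, ?_⟩ <;> grind
  · rintro ⟨h0, h1, h2, h3, h4⟩ s
    rcases pv_cases s with h | h | h | h | h | h | h | h | h | h <;> subst h <;>
      simp [adj_pv] <;> grind

lemma pv_comm (a b : Fin 5) (h : a ≠ b) : pv a b h = pv b a h.symm :=
  Subtype.ext (Finset.pair_comm a b)

lemma cyc_pv (a b c d x y : Fin 5) (h : x ≠ y) : cyc a b c d (pv x y h) =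
    (if ({x, y} : Finset (Fin 5)) = {a, b} then 1 else 0)
    - (if ({x, y} : Finset (Fin 5)) = {b, c} then 1 else 0)
    + (if ({x, y} : Finset (Fin 5)) = {c, d} then 1 else 0)
    - (if ({x, y} : Finset (Fin 5)) = {d, a} then 1 else 0) := rfl

lemma pair_iff (x y a b : Fin 5) : (({x, y} : Finset (Fin 5)) = {a, b}) ↔
    (x = a ∧ y = b ∨ x = b ∧ y = a) := by
  revert x y a b; decide

lemma T_apply (c : Fin 5 → ℂ) (s : PV) : T c s = c 0 * cyc 0 4 1 2 s + c 1 * cyc 2 4 1 0 s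
    + c 2 * cyc 1 3 0 2 s + c 3 * cyc 2 3 0 1 s + c 4 * cyc 3 4 1 0 s := rfl

lemma eig_eq : Module.End.eigenspace ((petersen.adjMatrix ℂ).mulVecLin) 1 = LinearMap.range T := by
  ext f
  rw [mem_star]
  constructor
  · rintro ⟨h0, h1, h2, h3, h4⟩
    refine ⟨![f (pv 0 4 (by decide)), f (pv 2 4 (by decide)), f (pv 1 3 (by decide)),
      f (pv 2 3 (by decide)), f (pv 3 4 (by decide))], ?_⟩
    funext s
    rw [T_apply]
    rcases pv_cases s with h | h | h | h | h | h | h | h | h | h <;> subst h <;>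
      simp [cyc_pv, pair_iff] <;> grind
  · rintro ⟨c, rfl⟩
    simp [T_apply, cyc_pv, pair_iff]
    grind

lemma T_inj : Function.Injective T := by
  rw [← LinearMap.ker_eq_bot, LinearMap.ker_eq_bot']
  intro c hc
  have h (s) : T c s = 0 := by rw [hc]; rfl
  have h0 := h (pv 0 4 (by decide))
  have h1 := h (pv 2 4 (by decide))
  have h2 := h (pv 1 3 (by decide))
  have h3 := h (pv 2 3 (by decide))
  have h4 := h (pv 3 4 (by decide))
  simp [T_apply, cyc_pv, pair_iff] at h0 h1 h2 h3 h4
  funext i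
  fin_cases i <;> simp [*]

lemma permRep_pv (σ : Equiv.Perm (Fin 5)) (f : PV → ℂ) (a b : Fin 5) (h : a ≠ b) :
    permRep σ f (pv a b h) = f (pv (σ⁻¹ a) (σ⁻¹ b) ((σ⁻¹).injective.ne h)) := by
  rw [← vertAct_pv]; rfl

lemma key (W : Submodule ℂ (PV → ℂ))
    (hW : ∀ (σ : Equiv.Perm (Fin 5)) (f), f ∈ W → permRep σ f ∈ W)
    (hC : cyc 0 1 2 3 ∉ W) (f : PV → ℂ) (hf : f ∈ W) :
    f (pv 0 1 (by decide)) - f (pv 1 2 (by decide)) + f (pv 2 3 (by decide))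
      - f (pv 0 3 (by decide)) = 0 := by
  by_contra hne
  apply hC
  rw [← W.smul_mem_iff hne]
  have h1 := hW (Equiv.swap 0 2) f hf
  have h2 := hW (Equiv.swap 1 3) f hf
  have h3 := hW (Equiv.swap 0 2) _ h2
  have h4 := W.add_mem (W.sub_mem (W.sub_mem hf h1) h2) h3
  convert h4 using 1
  funext s
  rcases pv_cases s with h | h | h | h | h | h | h | h | h | h <;> subst h <;>
    simp [cyc_pv, pair_iff, permRep_pv, Equiv.swap_apply_def] <;>
    simp only [pv_comm 1 0, pv_comm 2 0, pv_comm 3 0, pv_comm 2 1, pv_comm 3 1, pv_comm 3 2,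
      pv_comm 4 0, pv_comm 4 1, pv_comm 4 2, pv_comm 4 3] <;> ring

lemma key' (W : Submodule ℂ (PV → ℂ))
    (hW : ∀ (σ : Equiv.Perm (Fin 5)) (f), f ∈ W → permRep σ f ∈ W)
    (hC : cyc 0 1 2 3 ∉ W) (f : PV → ℂ) (hf : f ∈ W) (a b c d : Fin 5)
    (hab : a ≠ b) (hbc : b ≠ c) (hcd : c ≠ d) (had : a ≠ d)
    (hτ : ∃ τ : Equiv.Perm (Fin 5), τ 0 = a ∧ τ 1 = b ∧ τ 2 = c ∧ τ 3 = d) :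
    f (pv a b hab) - f (pv b c hbc) + f (pv c d hcd) - f (pv a d had) = 0 := by
  obtain ⟨τ, rfl, rfl, rfl, rfl⟩ := hτ
  have := key W hW hC _ (hW τ⁻¹ f hf)
  simpa only [permRep_pv, inv_inv] using this

lemma key'' (W : Submodule ℂ (PV → ℂ))
    (hW : ∀ (σ : Equiv.Perm (Fin 5)) (f), f ∈ W → permRep σ f ∈ W)
    (hC : cyc 0 1 2 3 ∈ W) (a b c d : Fin 5)
    (hτ : ∃ τ : Equiv.Perm (Fin 5), τ 0 = a ∧ τ 1 = b ∧ τ 2 = c ∧ τ 3 = d) :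
    cyc a b c d ∈ W := by
  obtain ⟨τ, rfl, rfl, rfl, rfl⟩ := hτ
  rw [← permRep_cyc]
  exact hW _ _ hC

set_option maxRecDepth 100000 in
lemma ex1 : ∃ τ : Equiv.Perm (Fin 5), τ 0 = 0 ∧ τ 1 = 4 ∧ τ 2 = 1 ∧ τ 3 = 2 := by decide
set_option maxRecDepth 100000 in
lemma ex2 : ∃ τ : Equiv.Perm (Fin 5), τ 0 = 2 ∧ τ 1 = 4 ∧ τ 2 = 1 ∧ τ 3 = 0 := by decide
set_option maxRecDepth 100000 in
lemma ex3 : ∃ τ : Equiv.Perm (Fin 5), τ 0 = 1 ∧ τ 1 = 3 ∧ τ 2 = 0 ∧ τ 3 = 2 := by decide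
set_option maxRecDepth 100000 in
lemma ex4 : ∃ τ : Equiv.Perm (Fin 5), τ 0 = 2 ∧ τ 1 = 3 ∧ τ 2 = 0 ∧ τ 3 = 1 := by decide
set_option maxRecDepth 100000 in
lemma ex5 : ∃ τ : Equiv.Perm (Fin 5), τ 0 = 3 ∧ τ 1 = 4 ∧ τ 2 = 1 ∧ τ 3 = 0 := by decide

/-- The eigenspace of the adjacency operator of the Petersen graph for the
eigenvalue `1` is a 5-dimensional subspace, invariant under the natural action
of `S₅`, and the resulting representation of `S₅` on it is irreducible. -/
theorem petersen_eigenspace_one_irreducible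
    (V : Submodule ℂ ({s : Finset (Fin 5) // s.card = 2} → ℂ))
    (hV : V = Module.End.eigenspace ((petersen.adjMatrix ℂ).mulVecLin) 1) :
    Module.finrank ℂ V = 5 ∧
    (∀ (σ : Equiv.Perm (Fin 5)) (f), f ∈ V → permRep σ f ∈ V) ∧
    V ≠ ⊥ ∧
    (∀ W : Submodule ℂ ({s : Finset (Fin 5) // s.card = 2} → ℂ),
      W ≤ V → (∀ (σ : Equiv.Perm (Fin 5)) (f), f ∈ W → permRep σ f ∈ W) →
      W = ⊥ ∨ W = V) := by
  subst hV
  have hfr : Module.finrank ℂ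
      (Module.End.eigenspace ((petersen.adjMatrix ℂ).mulVecLin) 1) = 5 := by
    rw [eig_eq, LinearMap.finrank_range_of_inj T_inj]; simp
  refine ⟨hfr, ?_, ?_, ?_⟩
  · intro σ f hf
    rw [mem_eig] at hf ⊢
    intro s
    change _ = f (vertAct σ⁻¹ s)
    rw [← hf, ← (vertEquiv σ⁻¹).sum_comp
      (fun t => if petersen.Adj (vertAct σ⁻¹ s) t then f t else 0)]
    refine Finset.sum_congr rfl fun t _ => ?_
    change _ = if petersen.Adj (vertAct σ⁻¹ s) (vertAct σ⁻¹ t) then f (vertAct σ⁻¹ t) else 0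
    simp only [adj_vertAct]
    rfl
  · intro h
    rw [h] at hfr
    simp at hfr
  · intro W hWV hW
    by_cases hC : cyc 0 1 2 3 ∈ W
    · right
      refine le_antisymm hWV ?_
      rw [eig_eq]
      rintro _ ⟨c, rfl⟩
      exact W.add_mem (W.add_mem (W.add_mem (W.add_mem
        (W.smul_mem _ (key'' W hW hC _ _ _ _ ex1)) (W.smul_mem _ (key'' W hW hC _ _ _ _ ex2)))
        (W.smul_mem _ (key'' W hW hC _ _ _ _ ex3))) (W.smul_mem _ (key'' W hW hC _ _ _ _ ex4)))
        (W.smul_mem _ (key'' W hW hC _ _ _ _ ex5))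
    · left
      rw [Submodule.eq_bot_iff]
      intro f hf
      obtain ⟨h0, h1, h2, h3, h4⟩ := (mem_star f).1 (hWV hf)
      have k1 := key' W hW hC f hf _ _ _ _ (by decide) (by decide) (by decide) (by decide) ex1
      have k2 := key' W hW hC f hf _ _ _ _ (by decide) (by decide) (by decide) (by decide) ex2
      have k3 := key' W hW hC f hf _ _ _ _ (by decide) (by decide) (by decide) (by decide) ex3
      have k4 := key' W hW hC f hf _ _ _ _ (by decide) (by decide) (by decide) (by decide) ex4
      have k5 := key' W hW hC f hf _ _ _ _ (by decide) (by decide) (by decide) (by decide) ex5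
      simp only [pv_comm 1 0, pv_comm 2 0, pv_comm 3 0, pv_comm 2 1, pv_comm 3 1, pv_comm 3 2,
        pv_comm 4 0, pv_comm 4 1, pv_comm 4 2, pv_comm 4 3] at k1 k2 k3 k4 k5
      funext s
      change f s = 0
      rcases pv_cases s with h | h | h | h | h | h | h | h | h | h <;> subst h <;> grind
end
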